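/- arXiv:1306.5882 — 4 statements merged into one kernel-verified Lean document; each statement's English description precedes it below -/
import Mathlib

section
/- For every N ≥ 0 and every integer d ≥ 0, the assignment (A,B) ↦ (A^{+d}, B) induces a well-defined bijection from 𝕍_N^0 onto 𝕍_{N'}^d, where N' = N + ⌊d²/4⌋. Likewise, for every integer d ≥ 1, the assignment (C,D) ↦ (C^{+(d−1)}, D) induces a well-defined bijection from 𝕍_N^1 onto 𝕍_{N'}^d with the same N' = N + ⌊d²/4⌋. -/
namespace CSpaper

/-- The rank of a β-set: the sum of its elements minus `choose (card) 2`. -/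
def bRank (B : Finset ℕ) : ℤ :=
  (∑ b ∈ B, (b : ℤ)) - (B.card.choose 2 : ℤ)

/-- The `k`-th shift of a β-set: `{0,…,k-1} ∪ {b+k : b ∈ B}`. -/
def bShift (k : ℕ) (B : Finset ℕ) : Finset ℕ :=
  Finset.range k ∪ B.image (· + k)

/-- Shift-equivalence of β-sets. -/
def sEquiv (A B : Finset ℕ) : Prop :=
  ∃ k, bShift k A = B ∨ A = bShift k B

/-- A β-pair: an ordered pair of β-sets. -/
abbrev BPair := Finset ℕ × Finset ℕ

/-- The defect of a β-pair. -/
def pDefect (Λ : BPair) : ℤ := (Λ.1.card : ℤ) - (Λ.2.card : ℤ)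

/-- The rank of a β-pair: `rk A + rk B + ⌊(d/2)²⌋`. -/
def pRank (Λ : BPair) : ℤ := bRank Λ.1 + bRank Λ.2 + pDefect Λ ^ 2 / 4

/-- The `k`-th shift of a β-pair. -/
def pShift (k : ℕ) (Λ : BPair) : BPair := (bShift k Λ.1, bShift k Λ.2)

/-- Shift-equivalence of β-pairs: one is a shift of the other. -/
def pEquiv (Λ Ξ : BPair) : Prop := ∃ k, pShift k Λ = Ξ ∨ Λ = pShift k Ξ

/-- `Λ` is a representative of a symbol in `𝕍_N^d`. -/
def inV (N d : ℤ) (Λ : BPair) : Prop := pRank Λ = N ∧ pDefect Λ = d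

/-- The `i`-th smallest element of a finite set of naturals (0-indexed). -/
def nthEl (A : Finset ℕ) (i : ℕ) : ℕ := (A.sort (· ≤ ·)).getD i 0

/-- The operation `A ⊙ B = {a_1+b_1, a_2+b_2-1, …, a_s+b_s-(s-1)}` (0-indexed:
`a_i + b_i - i`). -/
def odot (A B : Finset ℕ) : Finset ℕ :=
  (Finset.range A.card).image fun i => nthEl A i + nthEl B i - i

/-- Dominance order `B ⊴ A`: every tail sum of `B` is at most the corresponding
tail sum of `A`. -/
def domLE (B A : Finset ℕ) : Prop :=
  ∀ k, ∑ i ∈ Finset.Ico k B.card, nthEl B i ≤ ∑ i ∈ Finset.Ico k A.card, nthEl A i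

/-- No two consecutive integers. -/
def noConsec (S : Finset ℕ) : Prop := ∀ x ∈ S, x + 1 ∉ S

/-- `{0,2,…,2k-2} ∪ {x+2k : x ∈ S}`. -/
def evShift (k : ℕ) (S : Finset ℕ) : Finset ℕ :=
  (Finset.range k).image (fun i => 2 * i) ∪ S.image (· + 2 * k)

/-- `{1,3,…,2k-1} ∪ {y+2k : y ∈ S}`. -/
def odShift (k : ℕ) (S : Finset ℕ) : Finset ℕ :=
  (Finset.range k).image (fun i => 2 * i + 1) ∪ S.image (· + 2 * k)

/-- The `k`-th shift in the 𝕐-family. -/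
def yShift (k : ℕ) (P : BPair) : BPair := (evShift k P.1, odShift k P.2)

/-- The `k`-th shift in the 𝕏-family. -/
def xShift (k : ℕ) (P : BPair) : BPair := (evShift k P.1, evShift k P.2)

/-- Shift-equivalence in the 𝕐-family. -/
def yEquiv (P Q : BPair) : Prop := ∃ k, yShift k P = Q ∨ P = yShift k Q

/-- Shift-equivalence in the 𝕏-family (unordered pairs, so swaps are allowed). -/
def xEquiv (P Q : BPair) : Prop :=
  ∃ k, xShift k P = Q ∨ xShift k P = Q.swap ∨ P = xShift k Q ∨ P.swap = xShift k Q

/-- Membership in `Ỹ_N`. -/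
def inYtilde (N : ℤ) (P : BPair) : Prop :=
  (∀ y ∈ P.2, 0 < y) ∧ Odd (P.1.card + P.2.card) ∧ noConsec P.1 ∧ noConsec P.2 ∧
    2 * ((∑ x ∈ P.1, (x : ℤ)) + ∑ y ∈ P.2, (y : ℤ)) =
      N + ((P.1.card + P.2.card : ℕ) : ℤ) * (((P.1.card + P.2.card : ℕ) : ℤ) - 1)

/-- The defect in the 𝕐-family: `|X| - |Y|`. -/
def yDefect (P : BPair) : ℤ := (P.1.card : ℤ) - (P.2.card : ℤ)

/-- Membership in `X̃_N`. -/
def inXtilde (N : ℤ) (P : BPair) : Prop :=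
  noConsec P.1 ∧ noConsec P.2 ∧
    2 * ((∑ x ∈ P.1, (x : ℤ)) + ∑ y ∈ P.2, (y : ℤ)) =
      N + (((P.1.card + P.2.card : ℕ) : ℤ) - 1) ^ 2 - 1

/-- The defect in the 𝕏-family: `||A| - |B||`. -/
def xDefect (P : BPair) : ℤ := |(P.1.card : ℤ) - (P.2.card : ℤ)|

/-- The map `Θ(A,B) = ({0, a_1+2, …, a_s+s+1}, {b_1+1, …, b_s+s})`. -/
def theta (Λ : BPair) : BPair :=
  (insert 0 ((Finset.range Λ.1.card).image fun i => nthEl Λ.1 i + i + 2),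
   (Finset.range Λ.2.card).image fun i => nthEl Λ.2 i + i + 1)

/-- The map `Θ'(A,B) = ({0, a_1+2, …, a_s+s+1}, {b_1, …, b_s+s-1})`. -/
def theta' (Λ : BPair) : BPair :=
  (insert 0 ((Finset.range Λ.1.card).image fun i => nthEl Λ.1 i + i + 2),
   (Finset.range Λ.2.card).image fun i => nthEl Λ.2 i + i)

/-- The map `Θ̄(A,B) = ({a_1, …, a_s+s-1}, {b_1, …, b_s+s-1})`. -/
def thetaBar (Λ : BPair) : BPair :=
  ((Finset.range Λ.1.card).image fun i => nthEl Λ.1 i + i,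
   (Finset.range Λ.2.card).image fun i => nthEl Λ.2 i + i)

/-- `ᵀΘ(A,B) = Θ(B,A)`. -/
def thetaT (Λ : BPair) : BPair := theta (Λ.2, Λ.1)

/-- `Π^d` for `d ≥ 1`: adjoin `{0,2,…,2d-4}` to the first row and add `2d-2`
to its entries. -/
def piPos (d : ℕ) (P : BPair) : BPair := (evShift (d - 1) P.1, P.2)

/-- `Π^d` for `d = -e ≤ -1`: adjoin `{1,3,…,2e+1}` to the second row and add
`2e+2` to its entries. -/
def piNeg (e : ℕ) (P : BPair) : BPair := (P.1, odShift (e + 1) P.2)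

/-- `Δ_B^t = Π^{2t+1} ∘ Θ'`. -/
def deltaB (t : ℕ) (Λ : BPair) : BPair := piPos (2 * t + 1) (theta' Λ)

/-- `Δ_C^t = Π^{4t+1} ∘ Θ`. -/
def deltaC (t : ℕ) (Λ : BPair) : BPair := piPos (4 * t + 1) (theta Λ)

/-- `Δ_{C'}^t = Π^{1-4t} ∘ ᵀΘ` (for `t ≥ 1`). -/
def deltaC' (t : ℕ) (Λ : BPair) : BPair := piNeg (4 * t - 1) (thetaT Λ)

/-- `Δ_D^t = Π^{4t} ∘ Θ'` (for `t ≥ 1`). -/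
def deltaD (t : ℕ) (Λ : BPair) : BPair := piPos (4 * t) (theta' Λ)

/-- `Δ_D^0 = Θ̄`. -/
def deltaD0 (Λ : BPair) : BPair := thetaBar Λ

/-- All entries of a pair (with multiplicity) in weakly increasing order. -/
def entries (P : BPair) : List ℕ := (P.1.val + P.2.val).sort (· ≤ ·)

/-- `Σ_j (len-1-j) ⬝ (L[j] - ref j)`, the common shape of `a`, `b` and `σ`. -/
def wsum (L : List ℕ) (ref : ℕ → ℕ) : ℤ :=
  ∑ j ∈ Finset.range L.length,
    ((L.length - 1 - j : ℕ) : ℤ) * ((L.getD j 0 : ℤ) - (ref j : ℤ))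

/-- Lusztig's a-function (reference sequence `0,0,1,1,…`). -/
def aFun (P : BPair) : ℤ := wsum (entries P) (fun j => j / 2)

/-- Lusztig's b-function with the 𝕏-reference sequence `0,0,2,2,…`. -/
def bX (P : BPair) : ℤ := wsum (entries P) (fun j => 2 * (j / 2))

/-- Lusztig's b-function with the 𝕐-reference sequence `0,1,2,…`. -/
def bY (P : BPair) : ℤ := wsum (entries P) (fun j => j)

/-- `σ(Λ) = Σ (2k-i)·x_i`. -/
def sigmaFun (P : BPair) : ℤ := wsum (entries P) (fun _ => 0)

/-- Entrywise sum of two rows (of equal size), sorted positions added. -/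
def addRows (X X' : Finset ℕ) : Finset ℕ :=
  (Finset.range X.card).image fun i => nthEl X i + nthEl X' i

/-- `Λ ⊕ Ξ` in the types B and D cases. -/
def oplus (Λ Ξ : BPair) : BPair := (addRows Λ.1 Ξ.1, addRows Λ.2 Ξ.2)

/-- `Λ ⊕ Ξ` in the type C case. -/
def oplusC (Λ Ξ : BPair) : BPair :=
  (insert (nthEl Ξ.1 0)
      ((Finset.range Λ.1.card).image fun i => nthEl Λ.1 i + nthEl Ξ.1 (i + 1) + 1),
   (Finset.range Λ.2.card).image fun j => nthEl Λ.2 j + nthEl Ξ.2 j + 1)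

/-- `Λ ⊞ Ξ`: the twisted combination in type D. -/
def boxplus (Λ Ξ : BPair) : BPair := (addRows Λ.2 Ξ.1, addRows Λ.1 Ξ.2)

/-- Similarity of β-pairs: after shifts, the row unions and row intersections
coincide. -/
def pSimilar (Λ Ξ : BPair) : Prop :=
  ∃ j k, (pShift j Λ).1 ∪ (pShift j Λ).2 = (pShift k Ξ).1 ∪ (pShift k Ξ).2 ∧
    (pShift j Λ).1 ∩ (pShift j Λ).2 = (pShift k Ξ).1 ∩ (pShift k Ξ).2

/-- Similarity in the 𝕏-family: after 𝕏-shifts, the row unions and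
intersections coincide. -/
def xSimilar (P Q : BPair) : Prop :=
  ∃ j k, (xShift j P).1 ∪ (xShift j P).2 = (xShift k Q).1 ∪ (xShift k Q).2 ∧
    (xShift j P).1 ∩ (xShift j P).2 = (xShift k Q).1 ∩ (xShift k Q).2

/-- A β-pair is reduced if it is not a proper shift, i.e. `0` does not lie in
both rows; each shift-equivalence class has a unique reduced representative. -/
def reduced (Λ : BPair) : Prop := ¬ (0 ∈ Λ.1 ∧ 0 ∈ Λ.2)

/-- `a(Λ) + a(Ξ) = b(Λ⊕Ξ)`, computed (as in the paper) on shift-representatives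
with matching row sizes. -/
def minimalPair (Λ Ξ : BPair) : Prop :=
  ∃ Λ' Ξ', pEquiv Λ Λ' ∧ pEquiv Ξ Ξ' ∧ Λ'.1.card = Ξ'.1.card ∧
    Λ'.2.card = Ξ'.2.card ∧ aFun Λ' + aFun Ξ' = bX (oplus Λ' Ξ')

/-- The generating relation `i ≈ i+1` whenever `c_i = c_{i+1}` or `d_i = d_{i+1}`. -/
def linkRel (n : ℕ) (c d : ℕ → ℕ) (i j : Fin n) : Prop :=
  (j : ℕ) = (i : ℕ) + 1 ∧ (c i = c j ∨ d i = d j)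

/-- The equivalence relation generated by `linkRel`. -/
def idxSetoid (n : ℕ) (c d : ℕ → ℕ) : Setoid (Fin n) :=
  ⟨Relation.EqvGen (linkRel n c d), Relation.EqvGen.is_equivalence _⟩

/-- A degenerate equivalence class: `{i, i+1}` with `c_i = c_{i+1}` and
`d_i = d_{i+1}`. -/
def degenClass (n : ℕ) (c d : ℕ → ℕ) (Q : Quotient (idxSetoid n c d)) : Prop :=
  ∃ i j : Fin n, (j : ℕ) = (i : ℕ) + 1 ∧ c i = c j ∧ d i = d j ∧
    Q = Quotient.mk (idxSetoid n c d) i ∧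
    ∀ m : Fin n, Quotient.mk (idxSetoid n c d) m = Q → m = i ∨ m = j

/-- The number `ℓ` of non-degenerate equivalence classes. -/
noncomputable def ellCount (n : ℕ) (c d : ℕ → ℕ) : ℕ :=
  Nat.card {Q : Quotient (idxSetoid n c d) // ¬ degenClass n c d Q}

/-- `Ξ` is obtained from `Λ` by decreasing a single entry by `1`, the result
again being a β-pair. -/
def stepDown (Λ Ξ : BPair) : Prop :=
  (∃ x ∈ Λ.1, 0 < x ∧ x - 1 ∉ Λ.1 ∧ Ξ = (insert (x - 1) (Λ.1.erase x), Λ.2)) ∨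
  (∃ x ∈ Λ.2, 0 < x ∧ x - 1 ∉ Λ.2 ∧ Ξ = (Λ.1, insert (x - 1) (Λ.2.erase x)))

theorem mem_bShift {k x : ℕ} {B : Finset ℕ} :
    x ∈ bShift k B ↔ x < k ∨ ∃ b ∈ B, b + k = x := by
  simp [bShift]

theorem bShift_bShift (j k : ℕ) (B : Finset ℕ) : bShift j (bShift k B) = bShift (j + k) B := by
  ext x
  simp only [mem_bShift]
  constructor
  · rintro (h | ⟨y, h | ⟨b, hb, rfl⟩, rfl⟩)
    · exact .inl (by lia)
    · exact .inl (by lia)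
    · exact .inr ⟨b, hb, by lia⟩
  · rintro (h | ⟨b, hb, rfl⟩)
    · by_cases hx : x < j
      · exact .inl hx
      · exact .inr ⟨x - j, .inl (by lia), by lia⟩
    · exact .inr ⟨b + k, .inr ⟨b, hb, rfl⟩, by lia⟩

theorem bShift_comm (j k : ℕ) (B : Finset ℕ) : bShift j (bShift k B) = bShift k (bShift j B) := by
  rw [bShift_bShift, bShift_bShift, add_comm]

theorem bShift_injective (k : ℕ) : Function.Injective (bShift k) := by
  have mem_iff (B : Finset ℕ) (x : ℕ) : x + k ∈ bShift k B ↔ x ∈ B := by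
    simp [mem_bShift]
  intro A B h
  ext x
  rw [← mem_iff A, h, mem_iff]

theorem disjoint_range_image_add (k : ℕ) (B : Finset ℕ) :
    Disjoint (Finset.range k) (B.image (· + k)) := by
  simp [Finset.disjoint_left]
  lia

theorem card_bShift (k : ℕ) (B : Finset ℕ) : (bShift k B).card = B.card + k := by
  rw [bShift, Finset.card_union_of_disjoint (disjoint_range_image_add k B),
    Finset.card_image_of_injective _ (add_left_injective k), Finset.card_range, add_comm]

theorem bRank_bShift (k : ℕ) (B : Finset ℕ) : bRank (bShift k B) = bRank B := by
  have hchoose : (B.card + k).choose 2 = B.card.choose 2 + k.choose 2 + B.card * k := by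
    rw [Nat.add_choose_eq, Finset.Nat.sum_antidiagonal_eq_sum_range_succ_mk]
    simp [Finset.sum_range_succ]
    ring
  have hrange : ∑ i ∈ Finset.range k, (i : ℤ) = (k.choose 2 : ℤ) := by
    rw [← Nat.cast_sum, Finset.sum_range_id, Nat.choose_two_right]
  rw [bRank, card_bShift, hchoose, bShift, Finset.sum_union (disjoint_range_image_add k B),
    Finset.sum_image fun _ _ _ _ h => add_left_injective k h, hrange, bRank]
  simp only [Nat.cast_add, Nat.cast_mul, Finset.sum_add_distrib, Finset.sum_const, nsmul_eq_mul]
  ring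

theorem pDefect_bShift_left (m : ℕ) (A B : Finset ℕ) :
    pDefect (bShift m A, B) = pDefect (A, B) + m := by
  simp only [pDefect, card_bShift, Nat.cast_add]
  ring

theorem pDefect_bShift_right (m : ℕ) (A B : Finset ℕ) :
    pDefect (A, bShift m B) = pDefect (A, B) - m := by
  simp only [pDefect, card_bShift, Nat.cast_add]
  ring

theorem inV_bShift_left {N e : ℤ} {Λ : BPair} (m : ℕ) (h : inV N e Λ) :
    inV (N - e ^ 2 / 4 + (e + m) ^ 2 / 4) (e + m) (bShift m Λ.1, Λ.2) := by
  obtain ⟨rfl, rfl⟩ := h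
  refine ⟨?_, pDefect_bShift_left m Λ.1 Λ.2⟩
  rw [pRank, pRank, pDefect_bShift_left, bRank_bShift]
  ring

theorem inV_bShift_right {N e : ℤ} {Λ : BPair} (m : ℕ) (h : inV N e Λ) :
    inV (N - e ^ 2 / 4 + (e - m) ^ 2 / 4) (e - m) (Λ.1, bShift m Λ.2) := by
  obtain ⟨rfl, rfl⟩ := h
  refine ⟨?_, pDefect_bShift_right m Λ.1 Λ.2⟩
  rw [pRank, pRank, pDefect_bShift_right, bRank_bShift]
  ring

theorem pEquiv_bShift_left_iff (m : ℕ) (Λ Ξ : BPair) :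
    pEquiv (bShift m Λ.1, Λ.2) (bShift m Ξ.1, Ξ.2) ↔ pEquiv Λ Ξ := by
  simp only [pEquiv, pShift, Prod.ext_iff, bShift_comm _ m, (bShift_injective m).eq_iff]

theorem pEquiv_pShift_self (k : ℕ) (Λ : BPair) : pEquiv (pShift k Λ) Λ :=
  ⟨k, .inr rfl⟩

/-- Shifting the first row by `m` induces a bijection between the symbols of defect `e` and those
of defect `e + m`. -/
theorem bShift_left_bijection {N N' e d : ℤ} (m : ℕ) (hd : d = e + m)
    (hN : N' = N - e ^ 2 / 4 + d ^ 2 / 4) :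
    (∀ Λ : BPair, inV N e Λ → inV N' d (bShift m Λ.1, Λ.2)) ∧
    (∀ Λ Ξ : BPair, inV N e Λ → inV N e Ξ →
      (pEquiv Λ Ξ ↔ pEquiv (bShift m Λ.1, Λ.2) (bShift m Ξ.1, Ξ.2))) ∧
    (∀ Θ : BPair, inV N' d Θ → ∃ Λ : BPair, inV N e Λ ∧ pEquiv (bShift m Λ.1, Λ.2) Θ) := by
  subst hd hN
  refine ⟨fun Λ h => inV_bShift_left m h, fun Λ Ξ _ _ => (pEquiv_bShift_left_iff m Λ Ξ).symm,
    fun Θ h => ⟨(Θ.1, bShift m Θ.2), ?_, pEquiv_pShift_self m Θ⟩⟩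
  simpa using inV_bShift_right m h

/-- `(A,B) ↦ (A^{+d},B)` induces a bijection `𝕍_N^0 → 𝕍_{N'}^d`
and, for `d ≥ 1`, `(C,D) ↦ (C^{+(d-1)},D)` induces a bijection
`𝕍_N^1 → 𝕍_{N'}^d`, where `N' = N + ⌊d²/4⌋`. -/
theorem statement_1 (N d : ℕ) :
    ((∀ Λ : BPair, inV N 0 Λ →
        inV ((N : ℤ) + (d : ℤ) ^ 2 / 4) d (bShift d Λ.1, Λ.2)) ∧
     (∀ Λ Ξ : BPair, inV N 0 Λ → inV N 0 Ξ →
        (pEquiv Λ Ξ ↔ pEquiv (bShift d Λ.1, Λ.2) (bShift d Ξ.1, Ξ.2))) ∧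
     (∀ Θ : BPair, inV ((N : ℤ) + (d : ℤ) ^ 2 / 4) d Θ →
        ∃ Λ : BPair, inV N 0 Λ ∧ pEquiv (bShift d Λ.1, Λ.2) Θ)) ∧
    (1 ≤ d →
     (∀ Λ : BPair, inV N 1 Λ →
        inV ((N : ℤ) + (d : ℤ) ^ 2 / 4) d (bShift (d - 1) Λ.1, Λ.2)) ∧
     (∀ Λ Ξ : BPair, inV N 1 Λ → inV N 1 Ξ →
        (pEquiv Λ Ξ ↔
          pEquiv (bShift (d - 1) Λ.1, Λ.2) (bShift (d - 1) Ξ.1, Ξ.2))) ∧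
     (∀ Θ : BPair, inV ((N : ℤ) + (d : ℤ) ^ 2 / 4) d Θ →
        ∃ Λ : BPair, inV N 1 Λ ∧ pEquiv (bShift (d - 1) Λ.1, Λ.2) Θ)) := by
  refine ⟨bShift_left_bijection d (by simp) (by simp), fun hd => ?_⟩
  exact bShift_left_bijection (d - 1) (by rw [Nat.cast_sub hd]; simp) (by norm_num)

end CSpaper
end

section
/- Let A, B, C be β-sets of equal cardinality s. Then A⊙C ⊴ B⊙C if and only if A ⊴ B. In particular, if also C' is a β-set of cardinality s and both A⊙C ⊴ B⊙C and B⊙C' ⊴ A⊙C' hold, then A = B. -/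
namespace CSpaper

theorem nthEl_eq_orderEmbOfFin {A : Finset ℕ} {s : ℕ} (hA : A.card = s) {i : ℕ} (hi : i < s) :
    nthEl A i = A.orderEmbOfFin hA ⟨i, hi⟩ := by
  have hi' : i < (A.sort (· ≤ ·)).length := by simpa [hA] using hi
  rw [nthEl, List.getD_eq_getElem _ _ hi', Finset.orderEmbOfFin_apply]
  rfl

theorem nthEl_lt_nthEl {A : Finset ℕ} {i j : ℕ} (hij : i < j) (hj : j < A.card) :
    nthEl A i < nthEl A j := by
  rw [nthEl_eq_orderEmbOfFin rfl hj, nthEl_eq_orderEmbOfFin rfl (hij.trans hj)]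
  exact (A.orderEmbOfFin rfl).strictMono hij

theorem le_nthEl {A : Finset ℕ} {i : ℕ} (hi : i < A.card) : i ≤ nthEl A i := by
  induction i with
  | zero => exact Nat.zero_le _
  | succ i ih => exact (ih (by omega)).trans_lt (nthEl_lt_nthEl i.lt_succ_self hi)

theorem image_nthEl (A : Finset ℕ) : (Finset.range A.card).image (nthEl A) = A := by
  ext x
  simp only [Finset.mem_image, Finset.mem_range]
  constructor
  · rintro ⟨i, hi, rfl⟩
    rw [nthEl_eq_orderEmbOfFin rfl hi]
    exact Finset.orderEmbOfFin_mem _ _ _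
  · intro hx
    have hx' : x ∈ Set.range (A.orderEmbOfFin rfl) := by simpa using hx
    obtain ⟨i, rfl⟩ := hx'
    exact ⟨i, i.2, nthEl_eq_orderEmbOfFin rfl i.2⟩

theorem card_image_range {f : ℕ → ℕ} {s : ℕ} (hf : StrictMonoOn f (Set.Iio s)) :
    ((Finset.range s).image f).card = s := by
  rw [Finset.card_image_of_injOn (by simpa using hf.injOn), Finset.card_range]

theorem nthEl_image_range {f : ℕ → ℕ} {s : ℕ} (hf : StrictMonoOn f (Set.Iio s)) {i : ℕ}
    (hi : i < s) : nthEl ((Finset.range s).image f) i = f i := by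
  rw [nthEl_eq_orderEmbOfFin (card_image_range hf) hi]
  have h := Finset.orderEmbOfFin_unique (card_image_range hf) (f := fun j : Fin s => f j)
    (fun j => Finset.mem_image_of_mem f (Finset.mem_range.2 j.2))
    (fun j k hjk => hf j.2 k.2 hjk)
  exact (congrFun h ⟨i, hi⟩).symm

theorem strictMonoOn_odot {A C : Finset ℕ} {s : ℕ} (hA : A.card = s) (hC : C.card = s) :
    StrictMonoOn (fun i => nthEl A i + nthEl C i - i) (Set.Iio s) := by
  subst hA
  have key : ∀ i j, i < j → j < A.card →
      nthEl A i + nthEl C i - i < nthEl A j + nthEl C j - j := by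
    intro i j hij hj
    induction j, hij using Nat.le_induction with
    | base =>
      have h₁ := nthEl_lt_nthEl (A := A) i.lt_succ_self hj
      have h₂ := nthEl_lt_nthEl (A := C) i.lt_succ_self (hC ▸ hj)
      have h₃ := le_nthEl (A := A) (i := i) (by omega)
      simp only [Nat.succ_eq_add_one] at *
      omega
    | succ j _ ih =>
      have h₁ := nthEl_lt_nthEl (A := A) j.lt_succ_self hj
      have h₂ := nthEl_lt_nthEl (A := C) j.lt_succ_self (hC ▸ hj)
      have h₃ := le_nthEl (A := A) (i := j) (by omega)
      have h₄ := ih (by omega)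
      simp only [Nat.succ_eq_add_one] at *
      omega
  exact fun i _ j hj hij => key i j hij hj

theorem sum_Ico_nthEl_odot {A C : Finset ℕ} {s : ℕ} (hA : A.card = s) (hC : C.card = s) (k : ℕ) :
    ∑ i ∈ Finset.Ico k (odot A C).card, nthEl (odot A C) i =
      ∑ i ∈ Finset.Ico k s, nthEl A i + ∑ i ∈ Finset.Ico k s, (nthEl C i - i) := by
  have hmono := strictMonoOn_odot hA hC
  rw [odot, hA, card_image_range hmono, ← Finset.sum_add_distrib]
  refine Finset.sum_congr rfl fun i hi => ?_
  have hi' : i < s := (Finset.mem_Ico.1 hi).2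
  rw [nthEl_image_range hmono hi', Nat.add_sub_assoc (le_nthEl (hC ▸ hi'))]

theorem domLE_odot_iff {A B C : Finset ℕ} {s : ℕ} (hA : A.card = s) (hB : B.card = s)
    (hC : C.card = s) : domLE (odot A C) (odot B C) ↔ domLE A B := by
  simp only [domLE, sum_Ico_nthEl_odot hA hC, sum_Ico_nthEl_odot hB hC, hA, hB,
    add_le_add_iff_right]

theorem domLE_antisymm {A B : Finset ℕ} (h : A.card = B.card) (hAB : domLE A B)
    (hBA : domLE B A) : A = B := by
  have hsum k := (hAB k).antisymm (hBA k)
  rw [← image_nthEl A, ← image_nthEl B, h]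
  refine Finset.image_congr fun i hi => ?_
  have hi' : i < B.card := by simpa using hi
  have h₀ := hsum i
  have h₁ := hsum (i + 1)
  rw [h] at h₀ h₁
  rw [Finset.sum_eq_sum_Ico_succ_bot hi', Finset.sum_eq_sum_Ico_succ_bot hi'] at h₀
  omega

/-- `A⊙C ⊴ B⊙C ↔ A ⊴ B`; in particular if `A⊙C ⊴ B⊙C` and
`B⊙C' ⊴ A⊙C'` then `A = B`. -/
theorem statement_4 (s : ℕ) (A B C C' : Finset ℕ)
    (hA : A.card = s) (hB : B.card = s) (hC : C.card = s) (hC' : C'.card = s) :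
    (domLE (odot A C) (odot B C) ↔ domLE A B) ∧
    (domLE (odot A C) (odot B C) → domLE (odot B C') (odot A C') → A = B) := by
  have hiff := domLE_odot_iff hA hB hC
  exact ⟨hiff, fun h h' => domLE_antisymm (hA.trans hB.symm) (hiff.1 h)
    ((domLE_odot_iff hB hA hC').1 h')⟩

end CSpaper
end

section
/- For every even N ≥ 0 and every odd integer d (positive or negative), the map Π^d induces a well-defined bijection from 𝕐_N^1 onto 𝕐_{N+d(d−1)}^d. For every N ≥ 0 and every integer d ≥ 1, the map Π^d (applied to a representative (A,B) of a defect-1 class with A the row of larger cardinality) induces a well-defined bijection from 𝕏_N^1 onto 𝕏_{N+d²−1}^d. -/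
namespace CSpaper

theorem mem_evShift {k a : ℕ} {S : Finset ℕ} :
    a ∈ evShift k S ↔ (a < 2 * k ∧ a % 2 = 0) ∨ (2 * k ≤ a ∧ a - 2 * k ∈ S) := by
  simp only [evShift, Finset.mem_union, Finset.mem_image, Finset.mem_range]
  constructor
  · rintro (⟨i, hi, rfl⟩ | ⟨s, hs, rfl⟩)
    · left; omega
    · right; simpa using hs
  · rintro (h | ⟨h, hs⟩)
    · exact Or.inl ⟨a / 2, by omega, by omega⟩
    · exact Or.inr ⟨_, hs, by omega⟩

theorem mem_odShift {k a : ℕ} {S : Finset ℕ} :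
    a ∈ odShift k S ↔ (a < 2 * k ∧ a % 2 = 1) ∨ (2 * k ≤ a ∧ a - 2 * k ∈ S) := by
  simp only [odShift, Finset.mem_union, Finset.mem_image, Finset.mem_range]
  constructor
  · rintro (⟨i, hi, rfl⟩ | ⟨s, hs, rfl⟩)
    · left; omega
    · right; simpa using hs
  · rintro (h | ⟨h, hs⟩)
    · exact Or.inl ⟨a / 2, by omega, by omega⟩
    · exact Or.inr ⟨_, hs, by omega⟩

theorem evShift_evShift (j k : ℕ) (S : Finset ℕ) :
    evShift j (evShift k S) = evShift (j + k) S := by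
  ext a
  have h : a - 2 * j - 2 * k = a - 2 * (j + k) := by omega
  simp only [mem_evShift, h]
  by_cases hS : a - 2 * (j + k) ∈ S <;> simp only [hS, and_true, and_false, or_false] <;> omega

theorem odShift_odShift (j k : ℕ) (S : Finset ℕ) :
    odShift j (odShift k S) = odShift (j + k) S := by
  ext a
  have h : a - 2 * j - 2 * k = a - 2 * (j + k) := by omega
  simp only [mem_odShift, h]
  by_cases hS : a - 2 * (j + k) ∈ S <;> simp only [hS, and_true, and_false, or_false] <;> omega

theorem evShift_comm (j k : ℕ) (S : Finset ℕ) :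
    evShift j (evShift k S) = evShift k (evShift j S) := by
  rw [evShift_evShift, evShift_evShift, add_comm]

theorem odShift_comm (j k : ℕ) (S : Finset ℕ) :
    odShift j (odShift k S) = odShift k (odShift j S) := by
  rw [odShift_odShift, odShift_odShift, add_comm]

theorem evShift_injective (k : ℕ) : Function.Injective (evShift k) := by
  intro S T h
  ext a
  have := Finset.ext_iff.mp h (a + 2 * k)
  simpa [mem_evShift] using this

theorem odShift_injective (k : ℕ) : Function.Injective (odShift k) := by
  intro S T h
  ext a
  have := Finset.ext_iff.mp h (a + 2 * k)
  simpa [mem_odShift] using this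

theorem disjoint_evShift (k : ℕ) (S : Finset ℕ) :
    Disjoint ((Finset.range k).image (fun i => 2 * i)) (S.image (· + 2 * k)) := by
  simp only [Finset.disjoint_left, Finset.mem_image, Finset.mem_range]
  rintro _ ⟨i, hi, rfl⟩ ⟨s, -, hs⟩
  omega

theorem disjoint_odShift (k : ℕ) (S : Finset ℕ) :
    Disjoint ((Finset.range k).image (fun i => 2 * i + 1)) (S.image (· + 2 * k)) := by
  simp only [Finset.disjoint_left, Finset.mem_image, Finset.mem_range]
  rintro _ ⟨i, hi, rfl⟩ ⟨s, -, hs⟩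
  omega

theorem card_evShift (k : ℕ) (S : Finset ℕ) : (evShift k S).card = k + S.card := by
  rw [evShift, Finset.card_union_of_disjoint (disjoint_evShift k S),
    Finset.card_image_of_injective _ (fun a b h => by simpa using h),
    Finset.card_image_of_injective _ (add_left_injective _), Finset.card_range]

theorem card_odShift (k : ℕ) (S : Finset ℕ) : (odShift k S).card = k + S.card := by
  rw [odShift, Finset.card_union_of_disjoint (disjoint_odShift k S),
    Finset.card_image_of_injective _ (fun a b h => by simpa using h),
    Finset.card_image_of_injective _ (add_left_injective _), Finset.card_range]

theorem sum_evShift (k : ℕ) (S : Finset ℕ) :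
    ∑ a ∈ evShift k S, (a : ℤ) = k * (k - 1) + ∑ a ∈ S, (a : ℤ) + 2 * k * S.card := by
  have h : ∑ i ∈ Finset.range k, (2 * (i : ℤ)) = k * (k - 1) := by
    induction k with
    | zero => simp
    | succ k ih => rw [Finset.sum_range_succ, ih]; push_cast; ring
  rw [evShift, Finset.sum_union (disjoint_evShift k S),
    Finset.sum_image (fun a _ b _ h => by simpa using h),
    Finset.sum_image (add_left_injective _).injOn]
  push_cast
  rw [h, Finset.sum_add_distrib, Finset.sum_const, nsmul_eq_mul]
  ring

theorem sum_odShift (k : ℕ) (S : Finset ℕ) :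
    ∑ a ∈ odShift k S, (a : ℤ) = k * k + ∑ a ∈ S, (a : ℤ) + 2 * k * S.card := by
  have h : ∑ i ∈ Finset.range k, (2 * (i : ℤ) + 1) = k * k := by
    induction k with
    | zero => simp
    | succ k ih => rw [Finset.sum_range_succ, ih]; push_cast; ring
  rw [odShift, Finset.sum_union (disjoint_odShift k S),
    Finset.sum_image (fun a _ b _ h => by simpa using h),
    Finset.sum_image (add_left_injective _).injOn]
  push_cast
  rw [h, Finset.sum_add_distrib, Finset.sum_const, nsmul_eq_mul]
  ring

theorem noConsec.evShift {S : Finset ℕ} (hS : noConsec S) (k : ℕ) :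
    noConsec (evShift k S) := by
  intro x hx hx'
  rw [mem_evShift] at hx hx'
  rcases hx with hx | ⟨hx, hxS⟩
  · omega
  · rcases hx' with hx' | ⟨-, hxS'⟩
    · omega
    · exact hS _ hxS (by rwa [Nat.sub_add_comm hx] at hxS')

theorem pos_of_mem_odShift {S : Finset ℕ} (hS : ∀ y ∈ S, 0 < y) (k : ℕ) :
    ∀ y ∈ odShift k S, 0 < y := by
  intro y hy
  rcases mem_odShift.mp hy with hy | ⟨-, hy⟩
  · omega
  · have := hS _ hy
    omega

theorem noConsec.odShift {S : Finset ℕ} (hS : noConsec S) (hpos : ∀ y ∈ S, 0 < y) (k : ℕ) :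
    noConsec (odShift k S) := by
  intro x hx hx'
  rw [mem_odShift] at hx hx'
  rcases hx with hx | ⟨hx, hxS⟩
  · rcases hx' with hx' | ⟨-, hxS'⟩
    · omega
    · have := hpos _ hxS'
      omega
  · rcases hx' with hx' | ⟨-, hxS'⟩
    · omega
    · exact hS _ hxS (by rwa [Nat.sub_add_comm hx] at hxS')

theorem yEquiv_evShift_fst_iff (k : ℕ) (P Q : BPair) :
    yEquiv (evShift k P.1, P.2) (evShift k Q.1, Q.2) ↔ yEquiv P Q := by
  simp only [yEquiv, yShift, Prod.ext_iff, evShift_comm _ k, (evShift_injective k).eq_iff]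

theorem yEquiv_odShift_snd_iff (k : ℕ) (P Q : BPair) :
    yEquiv (P.1, odShift k P.2) (Q.1, odShift k Q.2) ↔ yEquiv P Q := by
  simp only [yEquiv, yShift, Prod.ext_iff, odShift_comm _ k, (odShift_injective k).eq_iff]

/-- For pairs whose first row is strictly larger, no swap can occur in a shift-equivalence. -/
theorem xEquiv_iff_of_card_lt {P Q : BPair} (hP : P.2.card < P.1.card)
    (hQ : Q.2.card < Q.1.card) :
    xEquiv P Q ↔ ∃ k, xShift k P = Q ∨ P = xShift k Q := by
  refine exists_congr fun k => ⟨?_, ?_⟩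
  · rintro (h | h | h | h)
    · exact Or.inl h
    · have h₁ := congrArg (fun R : BPair => R.1.card) h
      have h₂ := congrArg (fun R : BPair => R.2.card) h
      simp only [xShift, card_evShift, Prod.fst_swap, Prod.snd_swap] at h₁ h₂
      omega
    · exact Or.inr h
    · have h₁ := congrArg (fun R : BPair => R.1.card) h
      have h₂ := congrArg (fun R : BPair => R.2.card) h
      simp only [xShift, card_evShift, Prod.fst_swap, Prod.snd_swap] at h₁ h₂
      omega
  · rintro (h | h)
    · exact Or.inl h
    · exact Or.inr (Or.inr (Or.inl h))

theorem xEquiv_evShift_fst_iff (k : ℕ) {P Q : BPair} (hP : P.2.card < P.1.card)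
    (hQ : Q.2.card < Q.1.card) :
    xEquiv (evShift k P.1, P.2) (evShift k Q.1, Q.2) ↔ xEquiv P Q := by
  rw [xEquiv_iff_of_card_lt hP hQ, xEquiv_iff_of_card_lt
    (by simp only [card_evShift]; omega) (by simp only [card_evShift]; omega)]
  simp only [xShift, Prod.ext_iff, evShift_comm _ k, (evShift_injective k).eq_iff]

/-- for odd `d ≥ 1` (resp. odd `d = -e ≤ -1`) the map `Π^d`
induces a bijection `𝕐_N^1 → 𝕐_{N+d(d-1)}^d`; and for `d ≥ 1` the map `Π^d`
(applied to defect-1 representatives with larger first row) induces a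
bijection `𝕏_N^1 → 𝕏_{N+d²-1}^d`. -/
theorem statement_8 :
    (∀ N : ℕ, Even N → ∀ d : ℕ, Odd d →
      (∀ P : BPair, inYtilde N P → yDefect P = 1 →
        inYtilde (N + d * (d - 1)) (piPos d P) ∧ yDefect (piPos d P) = d) ∧
      (∀ P Q : BPair, inYtilde N P → yDefect P = 1 →
          inYtilde N Q → yDefect Q = 1 →
        (yEquiv P Q ↔ yEquiv (piPos d P) (piPos d Q))) ∧
      (∀ R : BPair, inYtilde (N + d * (d - 1)) R → yDefect R = d →
        ∃ P : BPair, inYtilde N P ∧ yDefect P = 1 ∧ yEquiv (piPos d P) R)) ∧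
    (∀ N : ℕ, Even N → ∀ e : ℕ, Odd e →
      (∀ P : BPair, inYtilde N P → yDefect P = 1 →
        inYtilde (N + e * (e + 1)) (piNeg e P) ∧ yDefect (piNeg e P) = -(e : ℤ)) ∧
      (∀ P Q : BPair, inYtilde N P → yDefect P = 1 →
          inYtilde N Q → yDefect Q = 1 →
        (yEquiv P Q ↔ yEquiv (piNeg e P) (piNeg e Q))) ∧
      (∀ R : BPair, inYtilde (N + e * (e + 1)) R → yDefect R = -(e : ℤ) →
        ∃ P : BPair, inYtilde N P ∧ yDefect P = 1 ∧ yEquiv (piNeg e P) R)) ∧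
    (∀ N : ℕ, ∀ d : ℕ, 1 ≤ d →
      (∀ P : BPair, inXtilde N P → P.1.card = P.2.card + 1 →
        inXtilde (N + d ^ 2 - 1) (piPos d P) ∧ xDefect (piPos d P) = d) ∧
      (∀ P Q : BPair, inXtilde N P → P.1.card = P.2.card + 1 →
          inXtilde N Q → Q.1.card = Q.2.card + 1 →
        (xEquiv P Q ↔ xEquiv (piPos d P) (piPos d Q))) ∧
      (∀ R : BPair, inXtilde (N + d ^ 2 - 1) R → xDefect R = d →
        ∃ P : BPair, inXtilde N P ∧ P.1.card = P.2.card + 1 ∧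
          xEquiv (piPos d P) R)) := by
  refine ⟨fun N _ d hd => ?_, fun N _ e he => ?_, fun N d hd => ?_⟩
  · obtain ⟨k, rfl⟩ : ∃ k, d = k + 1 := ⟨d - 1, by have := hd.pos; omega⟩
    simp only [piPos, Nat.add_sub_cancel]
    refine ⟨?_, fun P Q _ _ _ _ => (yEquiv_evShift_fst_iff k P Q).symm, ?_⟩
    · rintro ⟨X, Y⟩ ⟨hpos, hodd, hX, hY, hsum⟩ hdef
      simp only [yDefect, inYtilde, card_evShift, sum_evShift] at *
      refine ⟨⟨hpos, by grind, hX.evShift k, hY, ?_⟩, by push_cast; omega⟩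
      obtain hc : (X.card : ℤ) = Y.card + 1 := by omega
      push_cast at hsum ⊢
      rw [hc] at hsum ⊢
      linear_combination hsum
    · rintro ⟨X, Y⟩ ⟨hpos, hodd, hX, hY, hsum⟩ hdef
      refine ⟨(X, odShift k Y), ?_, ?_, k, Or.inr rfl⟩ <;>
        simp only [yDefect, inYtilde, card_odShift, sum_odShift] at *
      · refine ⟨pos_of_mem_odShift hpos k, by grind, hX, hY.odShift hpos k, ?_⟩
        obtain hc : (X.card : ℤ) = Y.card + k + 1 := by push_cast at hdef; omega
        push_cast at hsum ⊢
        rw [hc] at hsum ⊢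
        linear_combination hsum
      · push_cast at *; omega
  · simp only [piNeg]
    refine ⟨?_, fun P Q _ _ _ _ => (yEquiv_odShift_snd_iff (e + 1) P Q).symm, ?_⟩
    · rintro ⟨X, Y⟩ ⟨hpos, hodd, hX, hY, hsum⟩ hdef
      simp only [yDefect, inYtilde, card_odShift, sum_odShift] at *
      refine ⟨⟨pos_of_mem_odShift hpos _, by grind, hX, hY.odShift hpos _, ?_⟩,
        by push_cast; omega⟩
      obtain hc : (X.card : ℤ) = Y.card + 1 := by omega
      push_cast at hsum ⊢
      rw [hc] at hsum ⊢
      linear_combination hsum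
    · rintro ⟨X, Y⟩ ⟨hpos, hodd, hX, hY, hsum⟩ hdef
      refine ⟨(evShift (e + 1) X, Y), ?_, ?_, e + 1, Or.inr rfl⟩ <;>
        simp only [yDefect, inYtilde, card_evShift, sum_evShift] at *
      · refine ⟨hpos, by grind, hX.evShift _, hY, ?_⟩
        obtain hc : (Y.card : ℤ) = X.card + e := by omega
        push_cast at hsum ⊢
        rw [hc] at hsum ⊢
        linear_combination hsum
      · push_cast at *; omega
  · obtain ⟨k, rfl⟩ : ∃ k, d = k + 1 := ⟨d - 1, by omega⟩
    simp only [piPos, Nat.add_sub_cancel]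
    refine ⟨?_, fun P Q _ hP _ hQ =>
      (xEquiv_evShift_fst_iff k (by omega) (by omega)).symm, ?_⟩
    · rintro ⟨A, B⟩ ⟨hA, hB, hsum⟩ hdef
      simp only [xDefect, inXtilde, card_evShift, sum_evShift] at *
      refine ⟨⟨hA.evShift k, hB, ?_⟩, by rw [abs_of_nonneg] <;> push_cast <;> omega⟩
      push_cast [hdef] at hsum ⊢
      linear_combination hsum
    · rintro ⟨A, B⟩ ⟨hA, hB, hsum⟩ hdef
      simp only [xDefect] at hdef hA hB hsum
      rcases le_total B.card A.card with h | h
      · have hc : A.card = B.card + k + 1 := by rw [abs_of_nonneg (by omega)] at hdef; omega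
        refine ⟨(A, evShift k B), ⟨hA, hB.evShift k, ?_⟩, ?_, k, Or.inr (Or.inr (Or.inl rfl))⟩ <;>
          simp only [card_evShift, sum_evShift]
        · push_cast [hc] at hsum ⊢
          linear_combination hsum
        · omega
      · have hc : B.card = A.card + k + 1 := by rw [abs_of_nonpos (by omega)] at hdef; omega
        refine ⟨(B, evShift k A), ⟨hB, hA.evShift k, ?_⟩, ?_, k,
          Or.inr (Or.inr (Or.inr rfl))⟩ <;> simp only [card_evShift, sum_evShift]
        · push_cast [hc] at hsum ⊢
          linear_combination hsum
        · omega

end CSpaper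
end

section
/- (Aubert's monotonicity for Lusztig's b-function.) Let s ≥ 0 and let A_1, A_2, B_1, B_2 be β-sets of cardinality s with rk(A_i) = rk(B_i) and A_i ⊴ B_i for i = 1, 2. Then for each of the maps Δ ∈ {Δ_B^t (t ≥ 0), Δ_C^t (t ≥ 0), Δ_{C'}^t (t ≥ 1), Δ_D^t (t ≥ 1), Δ_D^0} one has b(Δ(B_1,B_2)) ≤ b(Δ(A_1,A_2)), with equality if and only if A_1 = B_1 and A_2 = B_2. -/
namespace CSpaper

/-- The sum of `min x y` over all `x ∈ M` and `y ∈ N`. -/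
def minSum (M N : Multiset ℕ) : ℕ := (M.map fun x => (N.map (min x)).sum).sum

/-- The multiset of the first `s` values of a sequence. -/
def initVals (s : ℕ) (p : ℕ → ℕ) : Multiset ℕ := (Multiset.range s).map p

theorem minSum_add_left (M M' N : Multiset ℕ) :
    minSum (M + M') N = minSum M N + minSum M' N := by
  simp [minSum]

theorem minSum_comm (M N : Multiset ℕ) : minSum M N = minSum N M := by
  unfold minSum
  rw [Multiset.sum_map_sum_map]
  simp only [min_comm]

theorem minSum_add_right (M N N' : Multiset ℕ) :
    minSum M (N + N') = minSum M N + minSum M N' := by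
  rw [minSum_comm, minSum_add_left, minSum_comm N, minSum_comm N']

theorem minSum_initVals (s : ℕ) (p : ℕ → ℕ) (N : Multiset ℕ) :
    minSum (initVals s p) N = (N.map fun y => ∑ i ∈ Finset.range s, min (p i) y).sum := by
  rw [minSum_comm]
  simp only [minSum, initVals, Multiset.map_map, Function.comp_def, min_comm]
  rfl

theorem minSum_initVals_self (p : ℕ → ℕ) (s : ℕ) (hp : MonotoneOn p (Set.Iio s)) :
    minSum (initVals s p) (initVals s p) =
      2 * ∑ k ∈ Finset.range s, ∑ i ∈ Finset.range k, p i + ∑ i ∈ Finset.range s, p i := by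
  have h : minSum (initVals s p) (initVals s p) =
      ∑ j ∈ Finset.range s, ∑ i ∈ Finset.range s, min (p i) (p j) := by
    rw [minSum_initVals, initVals, Multiset.map_map]
    rfl
  rw [h]
  clear h
  induction s with
  | zero => simp
  | succ s ih =>
    have hp' : MonotoneOn p (Set.Iio s) :=
      hp.mono fun x hx => Set.mem_Iio.2 (Nat.lt_succ_of_lt hx)
    have h1 : ∑ i ∈ Finset.range s, min (p i) (p s) = ∑ i ∈ Finset.range s, p i := by
      refine Finset.sum_congr rfl fun i hi => min_eq_left ?_
      rw [Finset.mem_range] at hi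
      exact hp (Set.mem_Iio.2 (by omega)) (Set.mem_Iio.2 (by omega)) hi.le
    have h2 : ∑ j ∈ Finset.range s, min (p s) (p j) = ∑ i ∈ Finset.range s, p i := by
      rw [← h1]
      simp only [min_comm]
    simp only [Finset.sum_range_succ, Finset.sum_add_distrib, ih hp', h1, h2, min_self]
    ring

/-- The sequence `p` is dominated by `p'`: on the first `s` indices both have the same total, and every
initial sum of `p'` is at most that of `p`. -/
def InitLE (s : ℕ) (p' p : ℕ → ℕ) : Prop :=
  (∀ k ≤ s, ∑ i ∈ Finset.range k, p' i ≤ ∑ i ∈ Finset.range k, p i) ∧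
    ∑ i ∈ Finset.range s, p' i = ∑ i ∈ Finset.range s, p i

theorem sum_min_le_of_initLE {s : ℕ} {p p' : ℕ → ℕ} (hp : MonotoneOn p (Set.Iio s))
    (h : InitLE s p' p) (c : ℕ) :
    ∑ i ∈ Finset.range s, min (p' i) c ≤ ∑ i ∈ Finset.range s, min (p i) c := by
  obtain ⟨k, hks, hlo, hhi⟩ : ∃ k ≤ s, (∀ i < k, p i ≤ c) ∧ ∀ i < s, k ≤ i → c ≤ p i := by
    by_cases hex : ∃ i, i < s ∧ c < p i
    · classical
      refine ⟨Nat.find hex, (Nat.find_spec hex).1.le, fun i hi => ?_, fun i hi hki => ?_⟩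
      · by_contra hlt
        exact Nat.find_min hex hi ⟨hi.trans (Nat.find_spec hex).1, not_le.1 hlt⟩
      · exact (Nat.find_spec hex).2.le.trans
          (hp (Set.mem_Iio.2 (Nat.find_spec hex).1) (Set.mem_Iio.2 hi) hki)
    · push Not at hex
      exact ⟨s, le_rfl, hex, fun i hi hsi => absurd hi (not_lt.2 hsi)⟩
  rw [← Finset.sum_range_add_sum_Ico _ hks, ← Finset.sum_range_add_sum_Ico _ hks]
  refine add_le_add ?_ ?_
  · calc ∑ i ∈ Finset.range k, min (p' i) c ≤ ∑ i ∈ Finset.range k, p' i :=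
          Finset.sum_le_sum fun i _ => min_le_left _ _
      _ ≤ ∑ i ∈ Finset.range k, p i := h.1 k hks
      _ = ∑ i ∈ Finset.range k, min (p i) c :=
          Finset.sum_congr rfl fun i hi => (min_eq_left (hlo i (Finset.mem_range.1 hi))).symm
  · refine Finset.sum_le_sum fun i hi => ?_
    rw [Finset.mem_Ico] at hi
    rw [min_eq_right (hhi i hi.2 hi.1)]
    exact min_le_right _ _

theorem minSum_initVals_le {s : ℕ} {p p' : ℕ → ℕ} (hp : MonotoneOn p (Set.Iio s))
    (h : InitLE s p' p) (N : Multiset ℕ) :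
    minSum (initVals s p') N ≤ minSum (initVals s p) N := by
  rw [minSum_initVals, minSum_initVals]
  exact Multiset.sum_map_le_sum_map _ _ fun c _ => sum_min_le_of_initLE hp h c

theorem minSum_initVals_self_le {s : ℕ} {p p' : ℕ → ℕ} (hp : MonotoneOn p (Set.Iio s))
    (h : InitLE s p' p) :
    minSum (initVals s p') (initVals s p') ≤ minSum (initVals s p) (initVals s p) := by
  refine (minSum_initVals_le hp h _).trans ?_
  rw [minSum_comm]
  exact minSum_initVals_le hp h _

theorem eq_of_minSum_initVals_self_eq {s : ℕ} {p p' : ℕ → ℕ} (hp : MonotoneOn p (Set.Iio s))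
    (hp' : MonotoneOn p' (Set.Iio s)) (h : InitLE s p' p)
    (heq : minSum (initVals s p') (initVals s p') = minSum (initVals s p) (initVals s p)) :
    ∀ i < s, p' i = p i := by
  rw [minSum_initVals_self p s hp, minSum_initVals_self p' s hp', h.2] at heq
  have hsum : ∑ k ∈ Finset.range s, ∑ i ∈ Finset.range k, p' i =
      ∑ k ∈ Finset.range s, ∑ i ∈ Finset.range k, p i := by omega
  have hall := (Finset.sum_eq_sum_iff_of_le
    fun k hk => h.1 k (Finset.mem_range.1 hk).le).1 hsum
  have hk : ∀ k ≤ s, ∑ i ∈ Finset.range k, p' i = ∑ i ∈ Finset.range k, p i := by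
    intro k hks
    rcases hks.lt_or_eq with hlt | rfl
    · exact hall k (Finset.mem_range.2 hlt)
    · exact h.2
  intro i hi
  have h1 := hk (i + 1) hi
  rw [Finset.sum_range_succ, Finset.sum_range_succ, hk i hi.le] at h1
  omega

theorem minSum_cons_self (x : ℕ) (M : Multiset ℕ) (h : ∀ y ∈ M, x ≤ y) :
    minSum (x ::ₘ M) (x ::ₘ M) = (2 * M.card + 1) * x + minSum M M := by
  have h1 : minSum {x} M = M.card * x := by
    have : M.map (min x) = M.map fun _ => x :=
      Multiset.map_congr rfl fun y hy => min_eq_left (h y hy)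
    simp [minSum, this]
  have h2 : minSum {x} {x} = x := by simp [minSum]
  rw [← Multiset.singleton_add, minSum_add_left, minSum_add_right, minSum_add_right, minSum_comm M,
    h1, h2]
  ring

theorem two_mul_wsum_zero (L : List ℕ) (hL : L.Pairwise (· ≤ ·)) :
    2 * wsum L (fun _ => 0) + (L.sum : ℤ) = minSum (L : Multiset ℕ) L := by
  induction L with
  | nil => simp [wsum, minSum]
  | cons x L ih =>
    rw [List.pairwise_cons] at hL
    have hw : wsum (x :: L) (fun _ => 0) = wsum L (fun _ => 0) + L.length * x := by
      unfold wsum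
      rw [List.length_cons, Finset.sum_range_succ']
      congr 1
      refine Finset.sum_congr rfl fun j _ => ?_
      rw [List.getD_cons_succ, show L.length + 1 - 1 - (j + 1) = L.length - 1 - j by omega]
    rw [← Multiset.cons_coe, minSum_cons_self _ _ (by simpa using hL.1), hw]
    have := ih hL.2
    rw [List.sum_cons, Multiset.coe_card, Nat.cast_add, Nat.cast_add, Nat.cast_mul, ← this]
    push_cast [-Nat.cast_list_sum]
    ring

theorem wsum_eq_wsum_zero_sub (L : List ℕ) (ref : ℕ → ℕ) :
    wsum L ref = wsum L (fun _ => 0) -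
      ∑ j ∈ Finset.range L.length, ((L.length - 1 - j : ℕ) : ℤ) * (ref j : ℤ) := by
  unfold wsum
  rw [← Finset.sum_sub_distrib]
  exact Finset.sum_congr rfl fun j _ => by push_cast; ring

theorem two_mul_wsum_sort (M : Multiset ℕ) (ref : ℕ → ℕ) :
    2 * wsum (M.sort (· ≤ ·)) ref = minSum M M - M.sum -
      2 * ∑ j ∈ Finset.range M.card, ((M.card - 1 - j : ℕ) : ℤ) * (ref j : ℤ) := by
  have h := two_mul_wsum_zero (M.sort (· ≤ ·)) (Multiset.pairwise_sort M _)
  have hs : (M.sort (· ≤ ·)).sum = M.sum := by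
    rw [← Multiset.sum_coe, Multiset.sort_eq]
  rw [Multiset.sort_eq, hs] at h
  rw [wsum_eq_wsum_zero_sub, Multiset.length_sort]
  linarith

/-- The `b`-function decreases along `InitLE`, strictly so unless the sequences agree. -/
theorem wsum_sort_le_and_eq_iff {s : ℕ} {p p' q q' : ℕ → ℕ}
    (hp : MonotoneOn p (Set.Iio s)) (hp' : MonotoneOn p' (Set.Iio s))
    (hq : MonotoneOn q (Set.Iio s)) (hq' : MonotoneOn q' (Set.Iio s))
    (hpp : InitLE s p' p) (hqq : InitLE s q' q) (F : Multiset ℕ) (ref : ℕ → ℕ) :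
    wsum ((F + initVals s p' + initVals s q').sort (· ≤ ·)) ref ≤
        wsum ((F + initVals s p + initVals s q).sort (· ≤ ·)) ref ∧
      (wsum ((F + initVals s p' + initVals s q').sort (· ≤ ·)) ref =
          wsum ((F + initVals s p + initVals s q).sort (· ≤ ·)) ref ↔
        (∀ i < s, p' i = p i) ∧ ∀ i < s, q' i = q i) := by
  have e' := two_mul_wsum_sort (F + initVals s p' + initVals s q') ref
  have e := two_mul_wsum_sort (F + initVals s p + initVals s q) ref
  have hcard : (F + initVals s p' + initVals s q').card =
      (F + initVals s p + initVals s q).card := by simp [initVals]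
  have hsum (u : ℕ → ℕ) : (initVals s u).sum = ∑ i ∈ Finset.range s, u i := rfl
  have htot : (F + initVals s p' + initVals s q').sum =
      (F + initVals s p + initVals s q).sum := by
    simp only [Multiset.sum_add, hsum, hpp.2, hqq.2]
  rw [hcard, htot] at e'
  have expand (P Q : Multiset ℕ) : minSum (F + P + Q) (F + P + Q) =
      minSum F F + 2 * minSum P F + 2 * minSum Q F + 2 * minSum P Q + minSum P P + minSum Q Q := by
    simp only [minSum_add_left, minSum_add_right, minSum_comm F P, minSum_comm F Q, minSum_comm Q P]
    ring
  rw [expand] at e e'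
  have hPF := minSum_initVals_le hp hpp F
  have hQF := minSum_initVals_le hq hqq F
  have hPQ : minSum (initVals s p') (initVals s q') ≤ minSum (initVals s p) (initVals s q) := by
    refine (minSum_initVals_le hp hpp _).trans ?_
    rw [minSum_comm, minSum_comm _ (initVals s q)]
    exact minSum_initVals_le hq hqq _
  have hPP := minSum_initVals_self_le hp hpp
  have hQQ := minSum_initVals_self_le hq hqq
  refine ⟨by omega, fun heq => ⟨?_, ?_⟩, fun ⟨h1, h2⟩ => ?_⟩
  · exact eq_of_minSum_initVals_self_eq hp hp' hpp (by omega)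
  · exact eq_of_minSum_initVals_self_eq hq hq' hqq (by omega)
  · have congr_vals {u u' : ℕ → ℕ} (h : ∀ i < s, u' i = u i) : initVals s u' = initVals s u :=
      Multiset.map_congr rfl fun i hi => h i (Multiset.mem_range.1 hi)
    rw [congr_vals h1, congr_vals h2]

theorem sort_eq_map_nthEl (A : Finset ℕ) :
    A.sort (· ≤ ·) = (List.range A.card).map (nthEl A) := by
  refine List.ext_getElem (by simp) fun i h1 _ => ?_
  rw [List.getElem_map, List.getElem_range, nthEl, List.getD_eq_getElem _ _ h1]

theorem initVals_nthEl (A : Finset ℕ) : initVals A.card (nthEl A) = A.val := by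
  conv_rhs => rw [← Finset.sort_eq A (· ≤ ·), sort_eq_map_nthEl]
  rfl

theorem monotoneOn_nthEl (A : Finset ℕ) : MonotoneOn (nthEl A) (Set.Iio A.card) := by
  intro i hi j hj hij
  rw [Set.mem_Iio] at hi hj
  rcases hij.eq_or_lt with rfl | hlt
  · exact le_rfl
  have h := List.pairwise_iff_getElem.1 (Finset.pairwise_sort A (· ≤ ·)) i j
    (by simpa using hi) (by simpa using hj) hlt
  rwa [← List.getD_eq_getElem _ 0, ← List.getD_eq_getElem _ 0] at h

theorem monotoneOn_nthEl_add {s : ℕ} {A : Finset ℕ} (hA : A.card = s) (r : ℕ) :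
    MonotoneOn (fun i => nthEl A i + i + r) (Set.Iio s) := by
  subst hA
  intro i hi j hj hij
  have := monotoneOn_nthEl A hi hj hij
  dsimp only
  omega

theorem initLE_nthEl_add {s : ℕ} {A B : Finset ℕ} (hA : A.card = s) (hB : B.card = s)
    (hr : bRank A = bRank B) (hd : domLE A B) (r : ℕ) :
    InitLE s (fun i => nthEl B i + i + r) (fun i => nthEl A i + i + r) := by
  have hsum (C : Finset ℕ) : ∑ i ∈ Finset.range C.card, nthEl C i = ∑ c ∈ C, c := by
    have h := congrArg Multiset.sum (initVals_nthEl C)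
    rw [Finset.sum_val] at h
    exact h
  have htot : ∑ i ∈ Finset.range s, nthEl B i = ∑ i ∈ Finset.range s, nthEl A i := by
    unfold bRank at hr
    rw [hA, hB, sub_left_inj] at hr
    have hr' : ∑ b ∈ A, b = ∑ b ∈ B, b := by
      zify
      exact hr
    rw [← hsum, ← hsum, hA, hB] at hr'
    exact hr'.symm
  constructor
  · intro k hk
    have h := hd k
    rw [hA, hB] at h
    rw [← Finset.sum_range_add_sum_Ico _ hk, ← Finset.sum_range_add_sum_Ico _ hk] at htot
    simp only [Finset.sum_add_distrib]
    omega
  · simp only [Finset.sum_add_distrib, htot]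

theorem nthEl_add_eq_iff {s : ℕ} {A B : Finset ℕ} (hA : A.card = s) (hB : B.card = s) (r : ℕ) :
    (∀ i < s, nthEl B i + i + r = nthEl A i + i + r) ↔ A = B := by
  refine ⟨fun h => ?_, fun h => by simp [h]⟩
  rw [← Finset.val_inj, ← initVals_nthEl, ← initVals_nthEl, hA, hB]
  refine Multiset.map_congr rfl fun i hi => ?_
  have := h i (Multiset.mem_range.1 hi)
  omega

theorem image_nthEl_add_val {s : ℕ} {A : Finset ℕ} (hA : A.card = s) (r : ℕ) :
    ((Finset.range s).image fun i => nthEl A i + i + r).val =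
      initVals s fun i => nthEl A i + i + r := by
  subst hA
  refine Finset.image_val_of_injOn ?_
  rw [Finset.coe_range]
  refine StrictMonoOn.injOn fun i hi j hj hij => ?_
  have := monotoneOn_nthEl A hi hj hij.le
  omega

theorem map_add_initVals (s k : ℕ) (p : ℕ → ℕ) :
    (initVals s p).map (· + k) = initVals s fun i => p i + k := by
  simp [initVals]

theorem evShift_val (k : ℕ) (S : Finset ℕ) :
    (evShift k S).val = (Multiset.range k).map (fun i => 2 * i) + S.val.map (· + 2 * k) := by
  have hdisj : Disjoint ((Finset.range k).image fun i => 2 * i) (S.image (· + 2 * k)) := by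
    rw [Finset.disjoint_left]
    simp only [Finset.mem_image, Finset.mem_range]
    rintro x ⟨i, hi, rfl⟩ ⟨y, _, hy⟩
    omega
  rw [evShift, ← Finset.disjUnion_eq_union _ _ hdisj, Finset.disjUnion_val,
    Finset.image_val_of_injOn (fun i _ j _ h => by simpa using h),
    Finset.image_val_of_injOn (fun i _ j _ h => by simpa using h)]
  rfl

theorem odShift_val (k : ℕ) (S : Finset ℕ) :
    (odShift k S).val = (Multiset.range k).map (fun i => 2 * i + 1) + S.val.map (· + 2 * k) := by
  have hdisj : Disjoint ((Finset.range k).image fun i => 2 * i + 1) (S.image (· + 2 * k)) := by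
    rw [Finset.disjoint_left]
    simp only [Finset.mem_image, Finset.mem_range]
    rintro x ⟨i, hi, rfl⟩ ⟨y, _, hy⟩
    omega
  rw [odShift, ← Finset.disjUnion_eq_union _ _ hdisj, Finset.disjUnion_val,
    Finset.image_val_of_injOn (fun i _ j _ h => by simpa using h),
    Finset.image_val_of_injOn (fun i _ j _ h => by simpa using h)]
  rfl

theorem insert_zero_image_val {s : ℕ} {A : Finset ℕ} (hA : A.card = s) :
    (insert 0 ((Finset.range s).image fun i => nthEl A i + i + 2)).val =
      {0} + initVals s fun i => nthEl A i + i + 2 := by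
  rw [Finset.insert_val_of_notMem (by simp), image_nthEl_add_val hA, Multiset.singleton_add]

theorem entries_piPos_theta (d : ℕ) {s : ℕ} {A B : Finset ℕ} (hA : A.card = s) (hB : B.card = s) :
    entries (piPos d (theta (A, B))) =
      ((Multiset.range (d - 1)).map (fun i => 2 * i) + {2 * (d - 1)} +
        initVals s (fun i => nthEl A i + i + (2 + 2 * (d - 1))) +
        initVals s (fun i => nthEl B i + i + 1)).sort (· ≤ ·) := by
  simp only [entries, piPos, theta, hA, hB, evShift_val, insert_zero_image_val hA,
    image_nthEl_add_val hB, Multiset.map_add, map_add_initVals, Multiset.map_singleton, zero_add]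
  simp only [add_assoc]

theorem entries_piPos_theta' (d : ℕ) {s : ℕ} {A B : Finset ℕ} (hA : A.card = s)
    (hB : B.card = s) :
    entries (piPos d (theta' (A, B))) =
      ((Multiset.range (d - 1)).map (fun i => 2 * i) + {2 * (d - 1)} +
        initVals s (fun i => nthEl A i + i + (2 + 2 * (d - 1))) +
        initVals s (fun i => nthEl B i + i + 0)).sort (· ≤ ·) := by
  have hB0 := image_nthEl_add_val hB 0
  simp only [add_zero] at hB0
  simp only [entries, piPos, theta', hA, hB, evShift_val, insert_zero_image_val hA,
    hB0, Multiset.map_add, map_add_initVals, Multiset.map_singleton, zero_add]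
  simp only [add_assoc, add_zero]

theorem entries_piNeg_thetaT (e : ℕ) {s : ℕ} {A B : Finset ℕ} (hA : A.card = s)
    (hB : B.card = s) :
    entries (piNeg e (thetaT (A, B))) =
      ({0} + (Multiset.range (e + 1)).map (fun i => 2 * i + 1) +
        initVals s (fun i => nthEl A i + i + (1 + 2 * (e + 1))) +
        initVals s (fun i => nthEl B i + i + 2)).sort (· ≤ ·) := by
  simp only [entries, piNeg, thetaT, theta, hA, hB, odShift_val, insert_zero_image_val hB,
    image_nthEl_add_val hA, map_add_initVals]
  congr 1
  simp only [← add_assoc]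
  abel

theorem entries_thetaBar {s : ℕ} {A B : Finset ℕ} (hA : A.card = s) (hB : B.card = s) :
    entries (thetaBar (A, B)) =
      (0 + initVals s (fun i => nthEl A i + i + 0) +
        initVals s (fun i => nthEl B i + i + 0)).sort (· ≤ ·) := by
  have hA0 := image_nthEl_add_val hA 0
  have hB0 := image_nthEl_add_val hB 0
  simp only [add_zero] at hA0 hB0
  simp only [entries, thetaBar, hA, hB, hA0, hB0, zero_add, add_zero]

/-- Aubert's monotonicity: if `rk A_i = rk B_i` and `A_i ⊴ B_i`
then `b(Δ(B_1,B_2)) ≤ b(Δ(A_1,A_2))` for every map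
`Δ ∈ {Δ_B^t, Δ_C^t, Δ_{C'}^t (t≥1), Δ_D^t (t≥1), Δ_D^0}`, with equality iff
`A_1 = B_1` and `A_2 = B_2`. -/
theorem statement_9 (s : ℕ) (A1 A2 B1 B2 : Finset ℕ)
    (hA1 : A1.card = s) (hA2 : A2.card = s) (hB1 : B1.card = s) (hB2 : B2.card = s)
    (hr1 : bRank A1 = bRank B1) (hr2 : bRank A2 = bRank B2)
    (hd1 : domLE A1 B1) (hd2 : domLE A2 B2) :
    (∀ t : ℕ,
      bX (deltaB t (B1, B2)) ≤ bX (deltaB t (A1, A2)) ∧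
      (bX (deltaB t (B1, B2)) = bX (deltaB t (A1, A2)) ↔ A1 = B1 ∧ A2 = B2)) ∧
    (∀ t : ℕ,
      bY (deltaC t (B1, B2)) ≤ bY (deltaC t (A1, A2)) ∧
      (bY (deltaC t (B1, B2)) = bY (deltaC t (A1, A2)) ↔ A1 = B1 ∧ A2 = B2)) ∧
    (∀ t : ℕ, 1 ≤ t →
      bY (deltaC' t (B1, B2)) ≤ bY (deltaC' t (A1, A2)) ∧
      (bY (deltaC' t (B1, B2)) = bY (deltaC' t (A1, A2)) ↔ A1 = B1 ∧ A2 = B2)) ∧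
    (∀ t : ℕ, 1 ≤ t →
      bX (deltaD t (B1, B2)) ≤ bX (deltaD t (A1, A2)) ∧
      (bX (deltaD t (B1, B2)) = bX (deltaD t (A1, A2)) ↔ A1 = B1 ∧ A2 = B2)) ∧
    (bX (deltaD0 (B1, B2)) ≤ bX (deltaD0 (A1, A2)) ∧
      (bX (deltaD0 (B1, B2)) = bX (deltaD0 (A1, A2)) ↔ A1 = B1 ∧ A2 = B2)) := by
  have key (F : Multiset ℕ) (ref : ℕ → ℕ) (r r' : ℕ) :=
    wsum_sort_le_and_eq_iff (monotoneOn_nthEl_add hA1 r) (monotoneOn_nthEl_add hB1 r)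
      (monotoneOn_nthEl_add hA2 r') (monotoneOn_nthEl_add hB2 r')
      (initLE_nthEl_add hA1 hB1 hr1 hd1 r) (initLE_nthEl_add hA2 hB2 hr2 hd2 r') F ref
  simp only [nthEl_add_eq_iff hA1 hB1, nthEl_add_eq_iff hA2 hB2] at key
  refine ⟨fun t => ?_, fun t => ?_, fun t _ => ?_, fun t _ => ?_, ?_⟩
  · rw [bX, bX, deltaB, deltaB, entries_piPos_theta' _ hA1 hA2, entries_piPos_theta' _ hB1 hB2]
    exact key _ _ _ _
  · rw [bY, bY, deltaC, deltaC, entries_piPos_theta _ hA1 hA2, entries_piPos_theta _ hB1 hB2]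
    exact key _ _ _ _
  · rw [bY, bY, deltaC', deltaC', entries_piNeg_thetaT _ hA1 hA2,
      entries_piNeg_thetaT _ hB1 hB2]
    exact key _ _ _ _
  · rw [bX, bX, deltaD, deltaD, entries_piPos_theta' _ hA1 hA2, entries_piPos_theta' _ hB1 hB2]
    exact key _ _ _ _
  · rw [bX, bX, deltaD0, deltaD0, entries_thetaBar hA1 hA2, entries_thetaBar hB1 hB2]
    exact key _ _ _ _

end CSpaper
end
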